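/- Fix A > 0, L > 0, and U, V, φ₀, x_c ∈ ℝ, and let û(x) = A·exp(−(x−x_c)²/L² + i (x−x_c)² U / L + i (x−x_c) V + i φ₀). Let v_A, v_L, v_U, v_V, v_φ, v_{x_c} denote the partial derivatives of û with respect to A, L, U, V, φ₀, x_c respectively, and set c_A = A U (2 − 3V)/(8L), c_L = U(3V − 2)/4, c_U = (√2 A² L² (7V + 2) + 6V − 4)/(8L³), c_V = −A² U/(2√2 L), c_φ = (1/(32 L²))·( L² ( −5√2 A² (5V + 2) + 6 U² V + 4 (V − 1) V² ) − 6V + 8 ), c_{x_c} = (1/16)·( 5√2 A² + 3/L² + 3U² + V(3V − 4) + 8 ). Define the residual r(x) = c_A v_A + c_L v_L + c_U v_U + c_V v_V + c_φ v_φ + c_{x_c} v_{x_c} − F(û), where F(û)(x) = −(1/2) û′(x) − (i/8) û″(x) + (1/16) û‴(x) − (i/2)|û(x)|² û(x) − (3/2)|û(x)|² û′(x) + (1/4) û(x)² û′(x)*. Then Re ∫_ℝ v_k(x)* · r(x) dx = 0 for each k ∈ {A, L, U, V, φ, x_c}. -/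

import Mathlib

open MeasureTheory Real

lemma integrable_pow_mul_exp_neg_mul_sq {b : ℝ} (hb : 0 < b) (n : ℕ) :
    Integrable (fun x : ℝ => x ^ n * exp (-b * x ^ 2)) := by
  have h := integrable_rpow_mul_exp_neg_mul_sq hb (s := n)
    (by have := n.cast_nonneg (α := ℝ); linarith)
  simpa only [Real.rpow_natCast] using h

lemma integral_id_mul_exp_neg_mul_sq {b : ℝ} (hb : 0 < b) :
    ∫ x : ℝ, x ^ 1 * exp (-b * x ^ 2) = 0 := by
  have hd : ∀ x : ℝ, HasDerivAt (fun x : ℝ => exp (-b * x ^ 2))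
      (-(2 * b) * (x ^ 1 * exp (-b * x ^ 2))) x := fun x => by
    refine ((((hasDerivAt_id' x).fun_pow 2).const_mul (-b)).exp).congr_deriv ?_
    push_cast
    ring
  have h := integral_eq_zero_of_hasDerivAt_of_integrable hd
    ((integrable_pow_mul_exp_neg_mul_sq hb 1).const_mul _)
    (by simpa using integrable_pow_mul_exp_neg_mul_sq hb 0)
  rw [integral_const_mul] at h
  exact (mul_eq_zero.mp h).resolve_left (by linarith)

lemma integral_pow_add_two_mul_exp_neg_mul_sq {b : ℝ} (hb : 0 < b) (n : ℕ) :
    ∫ x : ℝ, x ^ (n + 2) * exp (-b * x ^ 2) =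
      (n + 1) / (2 * b) * ∫ x : ℝ, x ^ n * exp (-b * x ^ 2) := by
  have hd : ∀ x : ℝ, HasDerivAt (fun x : ℝ => x ^ (n + 1) * exp (-b * x ^ 2))
      ((n + 1) * (x ^ n * exp (-b * x ^ 2)) - (2 * b) * (x ^ (n + 2) * exp (-b * x ^ 2))) x :=
    fun x => by
      refine (((hasDerivAt_id' x).fun_pow (n + 1)).fun_mul
        (((hasDerivAt_id' x).fun_pow 2).const_mul (-b)).exp).congr_deriv ?_
      push_cast [Nat.add_sub_cancel]
      ring
  have h1 := (integrable_pow_mul_exp_neg_mul_sq hb n).const_mul ((n : ℝ) + 1)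
  have h2 := (integrable_pow_mul_exp_neg_mul_sq hb (n + 2)).const_mul (2 * b)
  have h := integral_eq_zero_of_hasDerivAt_of_integrable hd (h1.sub h2)
    (integrable_pow_mul_exp_neg_mul_sq hb (n + 1))
  rw [integral_sub h1 h2, integral_const_mul, integral_const_mul] at h
  rw [div_mul_eq_mul_div, eq_div_iff (by positivity)]
  linarith

/-- A real polynomial of degree at most five against a Gaussian. -/
lemma integral_quintic_mul_exp_neg_mul_sq {b : ℝ} (hb : 0 < b) (c : Fin 6 → ℝ) :
    Integrable (fun x : ℝ => (∑ i, c i * x ^ (i : ℕ)) * exp (-b * x ^ 2)) ∧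
    ∫ x : ℝ, (∑ i, c i * x ^ (i : ℕ)) * exp (-b * x ^ 2) =
      √(π / b) * (c 0 + c 2 / (2 * b) + 3 * c 4 / (4 * b ^ 2)) := by
  have hi : ∀ i ∈ Finset.univ, Integrable
      (fun x : ℝ => c i * (x ^ (i : ℕ) * exp (-b * x ^ 2))) :=
    fun i _ => (integrable_pow_mul_exp_neg_mul_sq hb i).const_mul _
  simp_rw [Finset.sum_mul, mul_assoc]
  refine ⟨integrable_finsetSum _ hi, ?_⟩
  have m0 : ∫ x : ℝ, x ^ 0 * exp (-b * x ^ 2) = √(π / b) := by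
    simpa using integral_gaussian b
  have m1 := integral_id_mul_exp_neg_mul_sq hb
  have m2 := integral_pow_add_two_mul_exp_neg_mul_sq hb 0
  have m3 := integral_pow_add_two_mul_exp_neg_mul_sq hb 1
  have m4 := integral_pow_add_two_mul_exp_neg_mul_sq hb 2
  have m5 := integral_pow_add_two_mul_exp_neg_mul_sq hb 3
  rw [m0] at m2
  rw [m1] at m3
  rw [m2] at m4
  rw [m3] at m5
  rw [integral_finsetSum _ hi]
  simp only [integral_const_mul, Fin.sum_univ_six]
  change c 0 * (∫ x : ℝ, x ^ 0 * exp (-b * x ^ 2)) + c 1 * (∫ x : ℝ, x ^ 1 * exp (-b * x ^ 2))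
    + c 2 * (∫ x : ℝ, x ^ (0 + 2) * exp (-b * x ^ 2))
    + c 3 * (∫ x : ℝ, x ^ (1 + 2) * exp (-b * x ^ 2))
    + c 4 * (∫ x : ℝ, x ^ (2 + 2) * exp (-b * x ^ 2))
    + c 5 * (∫ x : ℝ, x ^ (3 + 2) * exp (-b * x ^ 2)) = _
  rw [m0, m1, m2, m3, m4, m5]
  push_cast
  field_simp
  ring

/-- The real part of the integral of a function whose real part is a combination of the two
Gaussians occurring in the moments of the ansatz. -/
lemma re_integral_eq_zero_of_re_eq {f : ℝ → ℂ} {L x₀ : ℝ} (hL : 0 < L)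
    (c d : Fin 6 → ℝ)
    (h : ∀ x, (f x).re = (∑ i, c i * (x - x₀) ^ (i : ℕ)) * exp (-(2 / L ^ 2) * (x - x₀) ^ 2)
      + (∑ i, d i * (x - x₀) ^ (i : ℕ)) * exp (-(4 / L ^ 2) * (x - x₀) ^ 2))
    (h0 : √2 * (c 0 + c 2 * L ^ 2 / 4 + 3 * c 4 * L ^ 4 / 16)
      + (d 0 + d 2 * L ^ 2 / 8 + 3 * d 4 * L ^ 4 / 64) = 0) :
    (∫ x, f x).re = 0 := by
  by_cases hf : Integrable f
  swap
  · simp [integral_undef hf]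
  have hL2 : 0 < 2 / L ^ 2 := by positivity
  have hL4 : 0 < 4 / L ^ 2 := by positivity
  obtain ⟨i1, e1⟩ := integral_quintic_mul_exp_neg_mul_sq hL2 c
  obtain ⟨i2, e2⟩ := integral_quintic_mul_exp_neg_mul_sq hL4 d
  have hre : (∫ x, f x).re = ∫ x, (f x).re := (integral_re hf).symm
  simp_rw [hre, h]
  rw [integral_add (i1.comp_sub_right x₀) (i2.comp_sub_right x₀),
    integral_sub_right_eq_self
      (fun x => (∑ i, c i * x ^ (i : ℕ)) * exp (-(2 / L ^ 2) * x ^ 2)),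
    integral_sub_right_eq_self
      (fun x => (∑ i, d i * x ^ (i : ℕ)) * exp (-(4 / L ^ 2) * x ^ 2)), e1, e2]
  have hs : √(π / (2 / L ^ 2)) = √(π / (4 / L ^ 2)) * √2 := by
    rw [← sqrt_mul (by positivity)]
    congr 1
    field_simp
    norm_num
  have e : √(π / (4 / L ^ 2)) * (√2 * (c 0 + c 2 * L ^ 2 / 4 + 3 * c 4 * L ^ 4 / 16)
      + (d 0 + d 2 * L ^ 2 / 8 + 3 * d 4 * L ^ 4 / 64)) = 0 := by rw [h0, mul_zero]
  rw [hs, ← e]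
  field_simp
  ring

/-- Orthogonality of a quadratic multiple of a Gaussian wave packet `u` to a residual of the form
`u * (P + ‖u‖ ^ 2 * Q)`, where `P` is cubic and `Q` is linear, reduces to one identity between
the coefficients. -/
lemma re_integral_conj_mul_eq_zero {u v r : ℝ → ℂ} {A L x₀ : ℝ} (hL : 0 < L)
    (hu : ∀ x, (starRingEnd ℂ) (u x) * u x =
      ((A ^ 2 * exp (-(2 / L ^ 2) * (x - x₀) ^ 2) : ℝ) : ℂ))
    {r₀ r₁ r₂ r₃ s₀ s₁ s₂ s₃ g₀ g₁ h₀ h₁ : ℝ}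
    (hr : ∀ x, r x = u x *
      (⟨r₀ + r₁ * (x - x₀) + r₂ * (x - x₀) ^ 2 + r₃ * (x - x₀) ^ 3,
        s₀ + s₁ * (x - x₀) + s₂ * (x - x₀) ^ 2 + s₃ * (x - x₀) ^ 3⟩
      + (starRingEnd ℂ) (u x) * u x * ⟨g₀ + g₁ * (x - x₀), h₀ + h₁ * (x - x₀)⟩))
    (a₀ a₁ a₂ b₀ b₁ b₂ : ℝ)
    (hv : ∀ x, v x = u x *
      ⟨a₀ + a₁ * (x - x₀) + a₂ * (x - x₀) ^ 2, b₀ + b₁ * (x - x₀) + b₂ * (x - x₀) ^ 2⟩)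
    (h : √2 * ((a₀ * r₀ + b₀ * s₀)
        + (a₀ * r₂ + a₁ * r₁ + a₂ * r₀ + b₀ * s₂ + b₁ * s₁ + b₂ * s₀) * L ^ 2 / 4
        + 3 * (a₁ * r₃ + a₂ * r₂ + b₁ * s₃ + b₂ * s₂) * L ^ 4 / 16)
      + A ^ 2 * ((a₀ * g₀ + b₀ * h₀)
        + (a₁ * g₁ + a₂ * g₀ + b₁ * h₁ + b₂ * h₀) * L ^ 2 / 8) = 0) :
    (∫ x, (starRingEnd ℂ) (v x) * r x).re = 0 := by
  refine re_integral_eq_zero_of_re_eq (x₀ := x₀) hL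
    ![A ^ 2 * (a₀ * r₀ + b₀ * s₀),
      A ^ 2 * (a₀ * r₁ + a₁ * r₀ + b₀ * s₁ + b₁ * s₀),
      A ^ 2 * (a₀ * r₂ + a₁ * r₁ + a₂ * r₀ + b₀ * s₂ + b₁ * s₁ + b₂ * s₀),
      A ^ 2 * (a₀ * r₃ + a₁ * r₂ + a₂ * r₁ + b₀ * s₃ + b₁ * s₂ + b₂ * s₁),
      A ^ 2 * (a₁ * r₃ + a₂ * r₂ + b₁ * s₃ + b₂ * s₂),
      A ^ 2 * (a₂ * r₃ + b₂ * s₃)]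
    ![A ^ 4 * (a₀ * g₀ + b₀ * h₀),
      A ^ 4 * (a₀ * g₁ + a₁ * g₀ + b₀ * h₁ + b₁ * h₀),
      A ^ 4 * (a₁ * g₁ + a₂ * g₀ + b₁ * h₁ + b₂ * h₀),
      A ^ 4 * (a₂ * g₁ + b₂ * h₁), 0, 0] (fun x => ?_) ?_
  · have e : ∀ p P Q : ℂ, (starRingEnd ℂ) (u x * p)
        * (u x * (P + (starRingEnd ℂ) (u x) * u x * Q))
        = (starRingEnd ℂ) (u x) * u x * ((starRingEnd ℂ) p * P)
          + ((starRingEnd ℂ) (u x) * u x) ^ 2 * ((starRingEnd ℂ) p * Q) := fun p P Q => by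
      rw [map_mul]
      ring
    have hG : exp (-(4 / L ^ 2) * (x - x₀) ^ 2) = exp (-(2 / L ^ 2) * (x - x₀) ^ 2) ^ 2 := by
      rw [← Real.exp_nat_mul]
      congr 1
      push_cast
      ring
    rw [hv, hr, e, hu, ← Complex.ofReal_pow, Complex.add_re, Complex.re_ofReal_mul,
      Complex.re_ofReal_mul, hG]
    generalize exp (-(2 / L ^ 2) * (x - x₀) ^ 2) = G
    simp only [Fin.sum_univ_six, Complex.mul_re, Complex.conj_re, Complex.conj_im]
    simp
    ring
  · simp
    linear_combination A ^ 2 * h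

section Ansatz

variable (a l u v p c x : ℝ)

/-- The Gaussian ansatz with amplitude `a`, width `l`, chirp `u`, wave number `v`, phase `p` and
center `c`. -/
noncomputable def gaussianAnsatz : ℂ :=
  (a : ℂ) * Complex.exp (-((x : ℂ) - (c : ℂ)) ^ 2 / (l : ℂ) ^ 2
    + Complex.I * ((x : ℂ) - (c : ℂ)) ^ 2 * (u : ℂ) / (l : ℂ)
    + Complex.I * ((x : ℂ) - (c : ℂ)) * (v : ℂ) + Complex.I * (p : ℂ))

/-- The logarithmic derivative of the Gaussian ansatz in space. -/
noncomputable def gaussianAnsatzLogDeriv : ℂ :=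
  ⟨-2 * (x - c) / l ^ 2, 2 * u * (x - c) / l + v⟩

lemma conj_gaussianAnsatz_mul_self :
    (starRingEnd ℂ) (gaussianAnsatz a l u v p c x) * gaussianAnsatz a l u v p c x =
      ((a ^ 2 * exp (-(2 / l ^ 2) * (x - c) ^ 2) : ℝ) : ℂ) := by
  have e : -((x : ℂ) - (c : ℂ)) ^ 2 / (l : ℂ) ^ 2
      + Complex.I * ((x : ℂ) - (c : ℂ)) ^ 2 * (u : ℂ) / (l : ℂ)
      + Complex.I * ((x : ℂ) - (c : ℂ)) * (v : ℂ) + Complex.I * (p : ℂ)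
      = ((-(x - c) ^ 2 / l ^ 2 : ℝ) : ℂ)
        + (((x - c) ^ 2 * u / l + (x - c) * v + p : ℝ) : ℂ) * Complex.I := by
    push_cast
    ring
  rw [gaussianAnsatz, e, map_mul, ← Complex.exp_conj, mul_mul_mul_comm, ← Complex.exp_add,
    Complex.conj_ofReal, map_add, map_mul, Complex.conj_ofReal, Complex.conj_ofReal,
    Complex.conj_I]
  push_cast
  rw [← sq]
  congr 2
  ring

lemma gaussianAnsatzLogDeriv_eq : gaussianAnsatzLogDeriv l u v c x =
    -2 * ((x : ℂ) - c) / (l : ℂ) ^ 2 + (2 * u * ((x : ℂ) - c) / l + v) * Complex.I := by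
  rw [gaussianAnsatzLogDeriv, Complex.mk_eq_add_mul_I]
  push_cast
  rfl

lemma hasDerivAt_gaussianAnsatz_amplitude : HasDerivAt (fun a => gaussianAnsatz a l u v p c x)
    (gaussianAnsatz 1 l u v p c x) a := by
  have h := ((hasDerivAt_id' (a : ℂ)).mul_const
    (gaussianAnsatz 1 l u v p c x)).comp_ofReal
  simpa [gaussianAnsatz] using h

variable {l} in
lemma hasDerivAt_gaussianAnsatz_width (hl : l ≠ 0) :
    HasDerivAt (fun l => gaussianAnsatz a l u v p c x)
      (gaussianAnsatz a l u v p c x *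
        (2 * ((x : ℂ) - c) ^ 2 / (l : ℂ) ^ 3 - Complex.I * ((x : ℂ) - c) ^ 2 * u / (l : ℂ) ^ 2))
      l := by
  have hl' : (l : ℂ) ≠ 0 := by exact_mod_cast hl
  have h := (((((((hasDerivAt_id' (l : ℂ)).fun_pow 2).fun_inv (by simpa using hl')).const_mul
    (-((x : ℂ) - c) ^ 2)).fun_add (((hasDerivAt_id' (l : ℂ)).fun_inv hl').const_mul
    (Complex.I * ((x : ℂ) - c) ^ 2 * u))).add_const
    (Complex.I * ((x : ℂ) - c) * v + Complex.I * p)).cexp.const_mul (a : ℂ)).comp_ofReal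
  convert h using 1
  · funext l
    simp [gaussianAnsatz, div_eq_mul_inv, add_assoc]
  · simp [gaussianAnsatz, div_eq_mul_inv, add_assoc]
    field_simp
    ring

lemma hasDerivAt_gaussianAnsatz_chirp : HasDerivAt (fun u => gaussianAnsatz a l u v p c x)
    (gaussianAnsatz a l u v p c x * (Complex.I * ((x : ℂ) - c) ^ 2 / l)) u := by
  have h := (((((((hasDerivAt_id' (u : ℂ)).const_mul
    (Complex.I * ((x : ℂ) - c) ^ 2)).div_const (l : ℂ)).const_add
    (-((x : ℂ) - c) ^ 2 / (l : ℂ) ^ 2)).add_const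
    (Complex.I * ((x : ℂ) - c) * v)).add_const (Complex.I * p)).cexp.const_mul (a : ℂ)).comp_ofReal
  refine h.congr_deriv ?_
  simp [gaussianAnsatz]
  ring

lemma hasDerivAt_gaussianAnsatz_waveNumber : HasDerivAt (fun v => gaussianAnsatz a l u v p c x)
    (gaussianAnsatz a l u v p c x * (Complex.I * ((x : ℂ) - c))) v := by
  have h := (((((hasDerivAt_id' (v : ℂ)).const_mul
    (Complex.I * ((x : ℂ) - c))).const_add (-((x : ℂ) - c) ^ 2 / (l : ℂ) ^ 2
    + Complex.I * ((x : ℂ) - c) ^ 2 * u / l)).add_const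
    (Complex.I * p)).cexp.const_mul (a : ℂ)).comp_ofReal
  refine h.congr_deriv ?_
  simp [gaussianAnsatz]
  ring

lemma hasDerivAt_gaussianAnsatz_phase : HasDerivAt (fun p => gaussianAnsatz a l u v p c x)
    (gaussianAnsatz a l u v p c x * Complex.I) p := by
  have h := ((((hasDerivAt_id' (p : ℂ)).const_mul Complex.I).const_add
    (-((x : ℂ) - c) ^ 2 / (l : ℂ) ^ 2 + Complex.I * ((x : ℂ) - c) ^ 2 * u / l
    + Complex.I * ((x : ℂ) - c) * v)).cexp.const_mul (a : ℂ)).comp_ofReal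
  refine h.congr_deriv ?_
  simp [gaussianAnsatz]
  ring

lemma hasDerivAt_gaussianAnsatz : HasDerivAt (fun x => gaussianAnsatz a l u v p c x)
    (gaussianAnsatz a l u v p c x * gaussianAnsatzLogDeriv l u v c x) x := by
  have hy := (hasDerivAt_id' (x : ℂ)).sub_const (c : ℂ)
  have h := (((((hy.fun_pow 2).fun_neg.div_const ((l : ℂ) ^ 2)).fun_add
    ((((hy.fun_pow 2).const_mul Complex.I).mul_const (u : ℂ)).div_const (l : ℂ))).fun_add
    ((hy.const_mul Complex.I).mul_const (v : ℂ))).add_const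
    (Complex.I * p)).cexp.const_mul (a : ℂ) |>.comp_ofReal
  refine h.congr_deriv ?_
  simp [gaussianAnsatz, gaussianAnsatzLogDeriv_eq]
  ring

lemma hasDerivAt_gaussianAnsatz_center : HasDerivAt (fun c => gaussianAnsatz a l u v p c x)
    (gaussianAnsatz a l u v p c x * -gaussianAnsatzLogDeriv l u v c x) c := by
  have hy := (hasDerivAt_id' (c : ℂ)).const_sub (x : ℂ)
  have h := (((((hy.fun_pow 2).fun_neg.div_const ((l : ℂ) ^ 2)).fun_add
    ((((hy.fun_pow 2).const_mul Complex.I).mul_const (u : ℂ)).div_const (l : ℂ))).fun_add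
    ((hy.const_mul Complex.I).mul_const (v : ℂ))).add_const
    (Complex.I * p)).cexp.const_mul (a : ℂ) |>.comp_ofReal
  refine h.congr_deriv ?_
  simp [gaussianAnsatz, gaussianAnsatzLogDeriv_eq]
  ring

lemma hasDerivAt_gaussianAnsatzLogDeriv : HasDerivAt (fun x => gaussianAnsatzLogDeriv l u v c x)
    ⟨-2 / l ^ 2, 2 * u / l⟩ x := by
  have hy := (hasDerivAt_id' (x : ℂ)).sub_const (c : ℂ)
  have h := (((hy.const_mul (-2)).div_const ((l : ℂ) ^ 2)).fun_add
    ((((hy.const_mul (2 * u : ℂ)).div_const (l : ℂ)).add_const (v : ℂ)).mul_const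
      Complex.I)).comp_ofReal
  convert h using 1
  · funext x
    simp [gaussianAnsatzLogDeriv_eq]
  · rw [Complex.mk_eq_add_mul_I]
    simp

lemma deriv_gaussianAnsatz : deriv (fun x => gaussianAnsatz a l u v p c x) =
    fun x => gaussianAnsatz a l u v p c x * gaussianAnsatzLogDeriv l u v c x :=
  funext fun x => (hasDerivAt_gaussianAnsatz a l u v p c x).deriv

lemma deriv_deriv_gaussianAnsatz : deriv (deriv (fun x => gaussianAnsatz a l u v p c x)) =
    fun x => gaussianAnsatz a l u v p c x *
      (gaussianAnsatzLogDeriv l u v c x ^ 2 + ⟨-2 / l ^ 2, 2 * u / l⟩) := by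
  rw [deriv_gaussianAnsatz]
  funext x
  rw [((hasDerivAt_gaussianAnsatz a l u v p c x).fun_mul
    (hasDerivAt_gaussianAnsatzLogDeriv l u v c x)).deriv]
  ring

lemma deriv_deriv_deriv_gaussianAnsatz :
    deriv (deriv (deriv (fun x => gaussianAnsatz a l u v p c x))) =
    fun x => gaussianAnsatz a l u v p c x *
      (gaussianAnsatzLogDeriv l u v c x ^ 3
        + 3 * gaussianAnsatzLogDeriv l u v c x * ⟨-2 / l ^ 2, 2 * u / l⟩) := by
  rw [deriv_deriv_gaussianAnsatz]
  funext x
  rw [((hasDerivAt_gaussianAnsatz a l u v p c x).fun_mul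
    (((hasDerivAt_gaussianAnsatzLogDeriv l u v c x).fun_pow 2).add_const _)).deriv]
  push_cast
  ring

end Ansatz

/-- The RONS parameter velocities for the modified NLS (Dysthe) equation with the
modified Gaussian ansatz (equation (30) of the paper) make the instantaneous residual
orthogonal, in the real part of the `L²(ℝ,ℂ)` inner product, to every tangent direction
of the ansatz manifold. -/
theorem stmt19 (A L U V φ₀ xc : ℝ) (hA : 0 < A) (hL : 0 < L) :
    let uh : ℝ → ℝ → ℝ → ℝ → ℝ → ℝ → ℝ → ℂ := fun a l u v p c x =>
      (a : ℂ) * Complex.exp (-((x : ℂ) - (c : ℂ)) ^ 2 / (l : ℂ) ^ 2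
        + Complex.I * ((x : ℂ) - (c : ℂ)) ^ 2 * (u : ℂ) / (l : ℂ)
        + Complex.I * ((x : ℂ) - (c : ℂ)) * (v : ℂ) + Complex.I * (p : ℂ))
    let vA : ℝ → ℂ := fun x => deriv (fun a => uh a L U V φ₀ xc x) A
    let vL : ℝ → ℂ := fun x => deriv (fun l => uh A l U V φ₀ xc x) L
    let vU : ℝ → ℂ := fun x => deriv (fun u => uh A L u V φ₀ xc x) U
    let vV : ℝ → ℂ := fun x => deriv (fun v => uh A L U v φ₀ xc x) V
    let vφ : ℝ → ℂ := fun x => deriv (fun p => uh A L U V p xc x) φ₀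
    let vxc : ℝ → ℂ := fun x => deriv (fun c => uh A L U V φ₀ c x) xc
    let cA : ℝ := A * U * (2 - 3 * V) / (8 * L)
    let cL : ℝ := U * (3 * V - 2) / 4
    let cU : ℝ := (Real.sqrt 2 * A ^ 2 * L ^ 2 * (7 * V + 2) + 6 * V - 4) / (8 * L ^ 3)
    let cV : ℝ := -(A ^ 2 * U) / (2 * Real.sqrt 2 * L)
    let cφ : ℝ := (1 / (32 * L ^ 2)) *
      (L ^ 2 * (-5 * Real.sqrt 2 * A ^ 2 * (5 * V + 2) + 6 * U ^ 2 * V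
          + 4 * (V - 1) * V ^ 2) - 6 * V + 8)
    let cxc : ℝ := (1 / 16) *
      (5 * Real.sqrt 2 * A ^ 2 + 3 / L ^ 2 + 3 * U ^ 2 + V * (3 * V - 4) + 8)
    let Fuh : ℝ → ℂ := fun x =>
      -(1 / 2 : ℂ) * deriv (fun y => uh A L U V φ₀ xc y) x
        - (Complex.I / 8) * deriv (deriv (fun y => uh A L U V φ₀ xc y)) x
        + (1 / 16 : ℂ) * deriv (deriv (deriv (fun y => uh A L U V φ₀ xc y))) x
        - (Complex.I / 2) * (‖uh A L U V φ₀ xc x‖ : ℂ) ^ 2 * uh A L U V φ₀ xc x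
        - (3 / 2 : ℂ) * (‖uh A L U V φ₀ xc x‖ : ℂ) ^ 2
            * deriv (fun y => uh A L U V φ₀ xc y) x
        + (1 / 4 : ℂ) * (uh A L U V φ₀ xc x) ^ 2
            * (starRingEnd ℂ) (deriv (fun y => uh A L U V φ₀ xc y) x)
    let r : ℝ → ℂ := fun x =>
      (cA : ℂ) * vA x + (cL : ℂ) * vL x + (cU : ℂ) * vU x + (cV : ℂ) * vV x
        + (cφ : ℂ) * vφ x + (cxc : ℂ) * vxc x - Fuh x
    (∫ x : ℝ, (starRingEnd ℂ) (vA x) * r x).re = 0 ∧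
    (∫ x : ℝ, (starRingEnd ℂ) (vL x) * r x).re = 0 ∧
    (∫ x : ℝ, (starRingEnd ℂ) (vU x) * r x).re = 0 ∧
    (∫ x : ℝ, (starRingEnd ℂ) (vV x) * r x).re = 0 ∧
    (∫ x : ℝ, (starRingEnd ℂ) (vφ x) * r x).re = 0 ∧
    (∫ x : ℝ, (starRingEnd ℂ) (vxc x) * r x).re = 0 := by
  intro uh vA vL vU vV vφ vxc cA cL cU cV cφ cxc Fuh r
  set u : ℝ → ℂ := gaussianAnsatz A L U V φ₀ xc
  set q : ℝ → ℂ := gaussianAnsatzLogDeriv L U V xc with hq_def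
  have hA0 := hA.ne'
  have hL0 := hL.ne'
  have hvA : ∀ x, vA x = u x * ((1 / A : ℝ) : ℂ) := fun x => by
    refine (hasDerivAt_gaussianAnsatz_amplitude A L U V φ₀ xc x).deriv.trans ?_
    have : (A : ℂ) ≠ 0 := by exact_mod_cast hA0
    simp [u, gaussianAnsatz]
    field_simp
  have hvL : ∀ x, vL x = u x * (2 * ((x : ℂ) - xc) ^ 2 / (L : ℂ) ^ 3
      - Complex.I * ((x : ℂ) - xc) ^ 2 * U / (L : ℂ) ^ 2) := fun x =>
    (hasDerivAt_gaussianAnsatz_width A U V φ₀ xc x hL0).deriv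
  have hvU : ∀ x, vU x = u x * (Complex.I * ((x : ℂ) - xc) ^ 2 / L) := fun x =>
    (hasDerivAt_gaussianAnsatz_chirp A L U V φ₀ xc x).deriv
  have hvV : ∀ x, vV x = u x * (Complex.I * ((x : ℂ) - xc)) := fun x =>
    (hasDerivAt_gaussianAnsatz_waveNumber A L U V φ₀ xc x).deriv
  have hvφ : ∀ x, vφ x = u x * Complex.I := fun x =>
    (hasDerivAt_gaussianAnsatz_phase A L U V φ₀ xc x).deriv
  have hvxc : ∀ x, vxc x = u x * -q x := fun x =>
    (hasDerivAt_gaussianAnsatz_center A L U V φ₀ xc x).deriv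
  have hu : ∀ x, (starRingEnd ℂ) (u x) * u x =
      ((A ^ 2 * exp (-(2 / L ^ 2) * (x - xc) ^ 2) : ℝ) : ℂ) :=
    conj_gaussianAnsatz_mul_self A L U V φ₀ xc
  obtain ⟨m, hm⟩ : ∃ m : ℝ, m = -2 / L ^ 2 := ⟨_, rfl⟩
  obtain ⟨n, hn⟩ : ∃ n : ℝ, n = 2 * U / L := ⟨_, rfl⟩
  have hF : ∀ x, Fuh x = u x * (-(1 / 2) * q x - Complex.I / 8 * (q x ^ 2 + ⟨m, n⟩)
      + 1 / 16 * (q x ^ 3 + 3 * q x * ⟨m, n⟩)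
      + (starRingEnd ℂ) (u x) * u x *
        (-(Complex.I / 2) - 3 / 2 * q x + 1 / 4 * (starRingEnd ℂ) (q x))) := fun x => by
    have h1 : deriv (fun y => uh A L U V φ₀ xc y) = fun x => u x * q x :=
      deriv_gaussianAnsatz A L U V φ₀ xc
    have h2 : deriv (deriv (fun y => uh A L U V φ₀ xc y)) =
        fun x => u x * (q x ^ 2 + ⟨m, n⟩) := by
      rw [hm, hn]
      exact deriv_deriv_gaussianAnsatz A L U V φ₀ xc
    have h3 : deriv (deriv (deriv (fun y => uh A L U V φ₀ xc y))) =
        fun x => u x * (q x ^ 3 + 3 * q x * ⟨m, n⟩) := by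
      rw [hm, hn]
      exact deriv_deriv_deriv_gaussianAnsatz A L U V φ₀ xc
    have h0 : uh A L U V φ₀ xc x = u x := rfl
    simp only [Fuh]
    rw [h3, h2, h1, h0, ← Complex.conj_mul', map_mul]
    ring
  have hq : ∀ x, q x = ⟨m * (x - xc), n * (x - xc) + V⟩ := fun x => by
    rw [hm, hn, hq_def, gaussianAnsatzLogDeriv]
    congr 1 <;> ring
  have hr : ∀ x, r x = u x *
      (⟨(cA / A - n / 8 + 3 * V * n / 16)
          + (m * (1 / 2 - cxc) - V * m / 4 + 3 * V ^ 2 * m / 16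
            - 3 * (m ^ 2 - n ^ 2) / 16) * (x - xc)
          + (2 * cL / L ^ 3 - m * n / 4 + 3 * V * m * n / 8) * (x - xc) ^ 2
          + (-(m ^ 3 - 3 * m * n ^ 2) / 16) * (x - xc) ^ 3,
        (cφ + V * (1 / 2 - cxc) - V ^ 2 / 8 + m / 8 + V ^ 3 / 16 - 3 * V * m / 16)
          + (cV + n * (1 / 2 - cxc) - V * n / 4 + 3 * V ^ 2 * n / 16
            - 3 * m * n / 8) * (x - xc)
          + (-cL * U / L ^ 2 + cU / L + (m ^ 2 - n ^ 2) / 8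
            - 3 * V * (m ^ 2 - n ^ 2) / 16) * (x - xc) ^ 2
          + (-(3 * m ^ 2 * n - n ^ 3) / 16) * (x - xc) ^ 3⟩
      + (starRingEnd ℂ) (u x) * u x *
        ⟨0 + 5 / 4 * m * (x - xc), (1 / 2 + 7 / 4 * V) + 7 / 4 * n * (x - xc)⟩) := fun x => by
    have e : r x = u x * ((cA / A + cL * (2 * ((x : ℂ) - xc) ^ 2 / (L : ℂ) ^ 3
          - Complex.I * ((x : ℂ) - xc) ^ 2 * U / (L : ℂ) ^ 2)
        + cU * (Complex.I * ((x : ℂ) - xc) ^ 2 / L) + cV * (Complex.I * ((x : ℂ) - xc))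
        + cφ * Complex.I - cxc * q x
        + 1 / 2 * q x + Complex.I / 8 * (q x ^ 2 + ⟨m, n⟩)
        - 1 / 16 * (q x ^ 3 + 3 * q x * ⟨m, n⟩))
        + (starRingEnd ℂ) (u x) * u x *
          (Complex.I / 2 + 3 / 2 * q x - 1 / 4 * (starRingEnd ℂ) (q x))) := by
      simp only [r]
      rw [hvA, hvL, hvU, hvV, hvφ, hvxc, hF]
      push_cast
      ring
    rw [e, hq]
    simp only [Complex.mk_eq_add_mul_I, map_add, map_mul, Complex.conj_ofReal, Complex.conj_I]
    push_cast
    congr 2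
    · ring_nf
      simp only [Complex.I_sq, Complex.I_pow_three]
      ring
    · congr 1
      ring
  have hs : √2 ^ 2 = 2 := sq_sqrt (by norm_num)
  refine ⟨?_, ?_, ?_, ?_, ?_, ?_⟩
  · refine re_integral_conj_mul_eq_zero hL hu hr (1 / A) 0 0 0 0 0 (fun x => ?_) ?_
    · rw [hvA, Complex.mk_eq_add_mul_I]
      push_cast
      ring
    · simp only [cA, cL, cU, cV, cφ, cxc, hm, hn]
      field_simp
      ring
  · refine re_integral_conj_mul_eq_zero hL hu hr 0 0 (2 / L ^ 3) 0 0 (-U / L ^ 2)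
      (fun x => ?_) ?_
    · rw [hvL, Complex.mk_eq_add_mul_I]
      push_cast
      ring
    · simp only [cA, cL, cU, cV, cφ, cxc, hm, hn]
      field_simp
      ring_nf
      simp only [hs]
      ring
  · refine re_integral_conj_mul_eq_zero hL hu hr 0 0 0 0 0 (1 / L) (fun x => ?_) ?_
    · rw [hvU, Complex.mk_eq_add_mul_I]
      push_cast
      ring
    · simp only [cA, cL, cU, cV, cφ, cxc, hm, hn]
      field_simp
      ring_nf
      simp only [hs]
      ring
  · refine re_integral_conj_mul_eq_zero hL hu hr 0 0 0 0 1 0 (fun x => ?_) ?_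
    · rw [hvV, Complex.mk_eq_add_mul_I]
      push_cast
      ring
    · simp only [cA, cL, cU, cV, cφ, cxc, hm, hn]
      field_simp
      ring_nf
      simp only [hs]
      ring
  · refine re_integral_conj_mul_eq_zero hL hu hr 0 0 0 1 0 0 (fun x => ?_) ?_
    · rw [hvφ, Complex.mk_eq_add_mul_I]
      push_cast
      ring
    · simp only [cA, cL, cU, cV, cφ, cxc, hm, hn]
      field_simp
      ring_nf
      simp only [hs]
      ring
  · refine re_integral_conj_mul_eq_zero hL hu hr 0 (-m) 0 (-V) (-n) 0 (fun x => ?_) ?_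
    · rw [hvxc, hq, Complex.mk_eq_add_mul_I, Complex.mk_eq_add_mul_I]
      push_cast
      ring
    · simp only [cA, cL, cU, cV, cφ, cxc, hm, hn]
      field_simp
      ring_nf
      simp only [hs]
      ring
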